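/- Decrease along a recursive time sequence. Let 𝒯 be an additive subgroup of ℝ, 𝒰 a set of inputs, and μᵃ, μᵇ input measures. Let β be of class 𝒦𝓛, r₀ ≥ 0, γ of class 𝒦 with γ(r) < r for all r > r₀, σ₁, σ₂, σ₃ of class 𝒦, and d, C ≥ 0. Set ϑ(s) := β(s,0), Ĉ := max{C, r₀}, σ̂₁(s) := max{σ₁(s), σ₃(ϑ(s))}, d̂ := max{σ₃(Ĉ), d}, and μᵐ(u,a,b) := max{β(σ₃(μᵃ(u,a,b)), 0), β(μᵇ(u,a,b), 0), μᵃ(u,a,b)}; let γⁱ denote the i-fold composition of γ (γ⁰ the identity). Fix r > 0, let (Tᵢ)_{i≥0} be a sequence in 𝒯₊ with T₀ = 0, define M₀ := r, Mᵢ := max{σ̂₁(r), σ₂(T₀ + ⋯ + Tᵢ), d̂} for i ≥ 1, and T̂ᵢ := T₀ + ⋯ + Tᵢ, and assume β(M_{i−1}, Tᵢ) ≤ γⁱ(ϑ(r)) for every i ≥ 1. Let (τ,u,x,y) be a trajectory satisfying (H1): for each t₀ ∈ [0,τ) and each t ∈ [t₀,τ), y(t) ≤ max{β(x(t₀), t−t₀),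 γ(‖y‖_{[t₀,t]}), μᵃ(u,t₀,t), C}; and (H2): for each t₀ ∈ [0,τ) and each t ∈ [t₀,τ), x(t) ≤ max{σ₁(x(t₀)), σ₂(t−t₀), σ₃(‖y‖_{[t₀,t]}), μᵇ(u,t₀,t), d}. Then for any t₀ ∈ [0,τ) with x(t₀) ≤ r and any i ≥ 0: y(t) ≤ max{γⁱ(ϑ(r)), μᵐ(u,t₀,t), Ĉ} for all t ∈ [t₀ + T̂ᵢ, τ). -/

import Mathlib

open Set Filter

/-- A function of class 𝒦: continuous, strictly increasing on `[0,∞)`, zero at zero,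
and nonnegative on `[0,∞)`. -/
def ClassK (γ : ℝ → ℝ) : Prop :=
  ContinuousOn γ (Ici 0) ∧ StrictMonoOn γ (Ici 0) ∧ γ 0 = 0 ∧ ∀ s, 0 ≤ s → 0 ≤ γ s

/-- A function of class 𝒦∞: class 𝒦 and unbounded. -/
def ClassKInf (γ : ℝ → ℝ) : Prop :=
  ClassK γ ∧ Tendsto γ atTop atTop

/-- A function of class 𝒦𝓛. -/
def ClassKL (β : ℝ → ℝ → ℝ) : Prop :=
  (∀ t, 0 ≤ t → ClassK (fun s => β s t)) ∧
  (∀ s, 0 ≤ s → ContinuousOn (β s) (Ici 0) ∧ AntitoneOn (β s) (Ici 0) ∧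
    Tendsto (β s) atTop (nhds 0))

/-- An input measure on the set of inputs `U`: nonnegative, and monotone as a set
function on finite subintervals of `[0,∞)`. -/
def InputMeasure {U : Type*} (μ : U → ℝ → ℝ → ℝ) : Prop :=
  (∀ u a b, 0 ≤ a → 0 ≤ b → 0 ≤ μ u a b) ∧
  (∀ u a b c d, 0 ≤ a → a ≤ b → b ≤ c → c ≤ d → μ u b c ≤ μ u a d)

/-- The sup norm of `y` over the interval `[a,b]` intersected with the time set `𝒯`. -/
noncomputable def supT (𝒯 : AddSubgroup ℝ) (y : ℝ → ℝ) (a b : ℝ) : ℝ :=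
  sSup (y '' {t : ℝ | t ∈ 𝒯 ∧ t ∈ Icc a b})

/-- `(τ, u, x, y)` is a trajectory: `0 < τ ≤ ∞`, `x` and `y` map `[0,τ)` (intersected
with the time set `𝒯`) into `[0,∞)`, and `y` is bounded on every interval
`[a,b] ⊆ [0,τ)`. -/
def IsTraj (𝒯 : AddSubgroup ℝ) (τ : EReal) (x y : ℝ → ℝ) : Prop :=
  0 < τ ∧
  (∀ t : ℝ, t ∈ 𝒯 → 0 ≤ t → (t : EReal) < τ → 0 ≤ x t ∧ 0 ≤ y t) ∧
  (∀ a b : ℝ, 0 ≤ a → a ≤ b → (b : EReal) < τ →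
    BddAbove (y '' {t : ℝ | t ∈ 𝒯 ∧ t ∈ Icc a b}))

/-- Hypothesis (H1) for the trajectory `(τ, u, x, y)`. -/
def H1 (𝒯 : AddSubgroup ℝ) {U : Type*} (μa : U → ℝ → ℝ → ℝ) (β : ℝ → ℝ → ℝ)
    (γ : ℝ → ℝ) (C : ℝ) (τ : EReal) (u : U) (x y : ℝ → ℝ) : Prop :=
  ∀ t0 t : ℝ, t0 ∈ 𝒯 → t ∈ 𝒯 → 0 ≤ t0 → t0 ≤ t → (t : EReal) < τ →
    y t ≤ max (max (β (x t0) (t - t0)) (γ (supT 𝒯 y t0 t))) (max (μa u t0 t) C)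

/-- Hypothesis (H2) for the trajectory `(τ, u, x, y)`. -/
def H2 (𝒯 : AddSubgroup ℝ) {U : Type*} (μb : U → ℝ → ℝ → ℝ)
    (σ1 σ2 σ3 : ℝ → ℝ) (d : ℝ) (τ : EReal) (u : U) (x y : ℝ → ℝ) : Prop :=
  ∀ t0 t : ℝ, t0 ∈ 𝒯 → t ∈ 𝒯 → 0 ≤ t0 → t0 ≤ t → (t : EReal) < τ →
    x t ≤ max (max (σ1 (x t0)) (σ2 (t - t0)))
      (max (σ3 (supT 𝒯 y t0 t)) (max (μb u t0 t) d))

theorem ClassK.mono' {g : ℝ → ℝ} (h : ClassK g) {a b : ℝ} (ha : 0 ≤ a) (hab : a ≤ b) :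
    g a ≤ g b :=
  h.2.1.monotoneOn (mem_Ici.2 ha) (mem_Ici.2 (ha.trans hab)) hab

theorem ClassK.le_of_le_max {g : ℝ → ℝ} (h : ClassK g) {a b c : ℝ} (ha : 0 ≤ a)
    (hab : a ≤ max b c) : g a ≤ max (g b) (g c) := by
  rcases le_max_iff.1 hab with h1 | h1
  · exact le_max_of_le_left (h.mono' ha h1)
  · exact le_max_of_le_right (h.mono' ha h1)

theorem ClassK.le_max_r0 {g : ℝ → ℝ} (h : ClassK g) {r0 : ℝ}
    (hg : ∀ r, r0 < r → g r < r) {z : ℝ} (hz : 0 ≤ z) : g z ≤ max z r0 := by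
  by_contra! hc
  obtain ⟨h1, h2⟩ := max_lt_iff.1 hc
  have h3 := hg (g z) h2
  have h4 := h.mono' hz h1.le
  linarith

theorem sup_bound {U : Type*} (𝒯 : AddSubgroup ℝ)
    (μa : U → ℝ → ℝ → ℝ) (hμa : InputMeasure μa)
    (β : ℝ → ℝ → ℝ) (hβ : ClassKL β)
    (r0 : ℝ)
    (γ : ℝ → ℝ) (hγ : ClassK γ) (hγr : ∀ r, r0 < r → γ r < r) (C : ℝ)
    (τ : EReal) (u : U) (x y : ℝ → ℝ) (htraj : IsTraj 𝒯 τ x y)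
    (hH1 : H1 𝒯 μa β γ C τ u x y) (s t : ℝ) (hs : s ∈ 𝒯) (hs0 : 0 ≤ s)
    (hst : s ≤ t) (htτ : (t : EReal) < τ) :
    supT 𝒯 y s t ≤ max (max (β (x s) 0) (μa u s t)) (max C r0) := by
  have hlt : ∀ v : ℝ, v ≤ t → (v : EReal) < τ := fun v hv =>
    lt_of_le_of_lt (EReal.coe_le_coe_iff.2 hv) htτ
  by_contra! hc
  obtain ⟨hc1, hc2⟩ := max_lt_iff.1 hc
  obtain ⟨hc3, hc4⟩ := max_lt_iff.1 hc1
  obtain ⟨hc5, hc6⟩ := max_lt_iff.1 hc2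
  have hS := hγr _ hc6
  have key : supT 𝒯 y s t ≤
      max (max (β (x s) 0) (γ (supT 𝒯 y s t))) (max (μa u s t) C) := by
    refine csSup_le ⟨y s, s, ⟨hs, le_rfl, hst⟩, rfl⟩ ?_
    rintro _ ⟨v, ⟨hv, hv1, hv2⟩, rfl⟩
    refine (hH1 s v hs hv hs0 hv1 (hlt v hv2)).trans ?_
    have hx := (htraj.2.1 s hs hs0 (hlt s hst)).1
    have hsub : supT 𝒯 y s v ≤ supT 𝒯 y s t := by
      refine csSup_le_csSup (htraj.2.2 s t hs0 hst htτ) ⟨y s, s, ⟨hs, le_rfl, hv1⟩, rfl⟩ ?_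
      apply image_mono
      rintro w ⟨hw, hw1, hw2⟩
      exact ⟨hw, hw1, hw2.trans hv2⟩
    have hnn : 0 ≤ supT 𝒯 y s v :=
      (htraj.2.1 s hs hs0 (hlt s hst)).2.trans
        (le_csSup (htraj.2.2 s v hs0 hv1 (hlt v hv2)) ⟨s, ⟨hs, le_rfl, hv1⟩, rfl⟩)
    exact max_le_max (max_le_max
      ((hβ.2 _ hx).2.1 (mem_Ici.2 le_rfl) (mem_Ici.2 (sub_nonneg.2 hv1)) (sub_nonneg.2 hv1))
      (hγ.mono' hnn hsub))
      (max_le_max (hμa.2 u s s v t hs0 le_rfl hv1 hv2) le_rfl)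
  exact absurd key (not_le.2 (max_lt (max_lt hc3 hS) (max_lt hc4 hc5)))

/-- Decrease claim in the proof of Theorem 1: along any trajectory satisfying (H1) and
(H2), with `ϑ(s) = β(s,0)`, `Ĉ = max {C,r₀}`, `σ̂₁(s) = max {σ₁(s), σ₃(ϑ(s))}`,
`d̂ = max {σ₃(Ĉ), d}`, times `Tᵢ ∈ 𝒯₊` with `T₀ = 0`, `T̂ᵢ = T₀ + ⋯ + Tᵢ`, `M₀ = r`,
`Mᵢ = max {σ̂₁(r), σ₂(T̂ᵢ), d̂}` for `i ≥ 1`, and `β(M_{i−1}, Tᵢ) ≤ γ^i(ϑ(r))` for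
`i ≥ 1`: if `x(t₀) ≤ r` then `y(t) ≤ max {γ^i(ϑ(r)), μᵐ(u,t₀,t), Ĉ}` for all
`t ∈ [t₀ + T̂ᵢ, τ)`, where
`μᵐ(u,a,b) = max {β(σ₃(μᵃ(u,a,b)),0), β(μᵇ(u,a,b),0), μᵃ(u,a,b)}`. -/
theorem output_decrease_along_time_sequence {U : Type*} (𝒯 : AddSubgroup ℝ)
    (μa μb : U → ℝ → ℝ → ℝ) (hμa : InputMeasure μa) (hμb : InputMeasure μb)
    (β : ℝ → ℝ → ℝ) (hβ : ClassKL β)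
    (r0 : ℝ) (hr0 : 0 ≤ r0)
    (γ : ℝ → ℝ) (hγ : ClassK γ) (hγr : ∀ r, r0 < r → γ r < r)
    (σ1 σ2 σ3 : ℝ → ℝ) (hσ1 : ClassK σ1) (hσ2 : ClassK σ2) (hσ3 : ClassK σ3)
    (d : ℝ) (hd : 0 ≤ d) (C : ℝ) (hC : 0 ≤ C)
    (r : ℝ) (hr : 0 < r)
    (Ts : ℕ → ℝ) (hTs : ∀ i, Ts i ∈ 𝒯 ∧ 0 ≤ Ts i) (hTs0 : Ts 0 = 0)
    (M : ℕ → ℝ) (hM0 : M 0 = r)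
    (hMi : ∀ i : ℕ, 1 ≤ i →
      M i = max (max (max (σ1 r) (σ3 (β r 0)))
        (σ2 (∑ j ∈ Finset.range (i + 1), Ts j))) (max (σ3 (max C r0)) d))
    (hdec : ∀ i : ℕ, 1 ≤ i → β (M (i - 1)) (Ts i) ≤ γ^[i] (β r 0))
    (τ : EReal) (u : U) (x y : ℝ → ℝ) (htraj : IsTraj 𝒯 τ x y)
    (hH1 : H1 𝒯 μa β γ C τ u x y)
    (hH2 : H2 𝒯 μb σ1 σ2 σ3 d τ u x y) :
    ∀ t0 : ℝ, t0 ∈ 𝒯 → 0 ≤ t0 → (t0 : EReal) < τ → x t0 ≤ r →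
      ∀ i : ℕ, ∀ t : ℝ, t ∈ 𝒯 →
        t0 + (∑ j ∈ Finset.range (i + 1), Ts j) ≤ t → (t : EReal) < τ →
          y t ≤ max (γ^[i] (β r 0))
            (max (max (max (β (σ3 (μa u t0 t)) 0) (β (μb u t0 t) 0)) (μa u t0 t))
              (max C r0)) := by
  intro t0 ht0 ht00 ht0τ hxr i
  have hϑ := hβ.1 0 le_rfl
  have hxnn := (htraj.2.1 t0 ht0 ht00 ht0τ).1
  have hsum : ∀ i : ℕ, (∑ j ∈ Finset.range (i + 1), Ts j) ∈ 𝒯 ∧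
      0 ≤ ∑ j ∈ Finset.range (i + 1), Ts j := fun i =>
    ⟨sum_mem fun j _ => (hTs j).1, Finset.sum_nonneg fun j _ => (hTs j).2⟩
  have hbase : ∀ t : ℝ, t0 ≤ t → (t : EReal) < τ →
      supT 𝒯 y t0 t ≤ max (max (β r 0) (μa u t0 t)) (max C r0) := fun t h1 h2 =>
    (sup_bound 𝒯 μa hμa β hβ r0 γ hγ hγr C τ u x y htraj hH1 t0 t ht0 ht00 h1 h2).trans
      (max_le_max (max_le_max (hϑ.mono' hxnn hxr) le_rfl) le_rfl)
  have hle : ∀ a t v : ℝ, 0 ≤ a → a ≤ v → v ≤ t → v ∈ 𝒯 → (t : EReal) < τ →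
      y v ≤ supT 𝒯 y a t := fun a t v h0 h1 h2 h3 h4 =>
    le_csSup (htraj.2.2 a t h0 (h1.trans h2) h4) ⟨v, ⟨h3, h1, h2⟩, rfl⟩
  have hnn : ∀ a t : ℝ, a ∈ 𝒯 → 0 ≤ a → a ≤ t → (t : EReal) < τ →
      0 ≤ supT 𝒯 y a t := fun a t h0 h1 h2 h3 =>
    (htraj.2.1 a h0 h1 (lt_of_le_of_lt (EReal.coe_le_coe_iff.2 h2) h3)).2.trans
      (hle a t a h1 le_rfl h2 h0 h3)
  induction i with
  | zero =>
    intro t ht h1 h2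
    have h3 : t0 ≤ t := by have := (hsum 0).2; linarith
    have h4 := (hle t0 t t ht00 h3 le_rfl ht h2).trans (hbase t h3 h2)
    simp only [Function.iterate_zero, id]
    grind
  | succ i ih =>
    intro t ht h1 h2
    obtain ⟨s, hs⟩ : ∃ s, s = t0 + ∑ j ∈ Finset.range (i + 1), Ts j := ⟨_, rfl⟩
    have hsT : s ∈ 𝒯 := hs ▸ add_mem ht0 (hsum i).1
    have h0s : t0 ≤ s := by have := (hsum i).2; linarith
    have hs0 : 0 ≤ s := ht00.trans h0s
    have hTi := (hTs (i + 1)).2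
    have hst' : Ts (i + 1) ≤ t - s := by
      rw [Finset.sum_range_succ] at h1; linarith
    have hst : s ≤ t := by linarith
    have h0t := h0s.trans hst
    have hsτ : (s : EReal) < τ := lt_of_le_of_lt (EReal.coe_le_coe_iff.2 hst) h2
    have ht0' : 0 ≤ t := hs0.trans hst
    have hann : 0 ≤ μa u t0 t := hμa.1 u t0 t ht00 ht0'
    have hbnn : 0 ≤ μb u t0 t := hμb.1 u t0 t ht00 ht0'
    have hxs := (htraj.2.1 s hsT hs0 hsτ).1
    obtain ⟨A, hA⟩ : ∃ A, A = max (max (β (σ3 (μa u t0 t)) 0) (β (μb u t0 t) 0)) (μa u t0 t) :=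
      ⟨_, rfl⟩
    have hA0 : 0 ≤ A := by rw [hA]; exact le_max_of_le_right hann
    have hĈ0 : 0 ≤ max C r0 := le_max_of_le_left hC
    -- bound on the supremum over the last interval
    have hS : supT 𝒯 y s t ≤ max (γ^[i] (β r 0)) (max A (max C r0)) := by
      refine csSup_le ⟨y s, s, ⟨hsT, le_rfl, hst⟩, rfl⟩ ?_
      rintro _ ⟨v, ⟨hv, hv1, hv2⟩, rfl⟩
      refine (ih v hv (hs ▸ hv1) (lt_of_le_of_lt (EReal.coe_le_coe_iff.2 hv2) h2)).trans ?_
      have e1 : μa u t0 v ≤ μa u t0 t := hμa.2 u t0 t0 v t ht00 le_rfl (h0s.trans hv1) hv2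
      have e2 : μb u t0 v ≤ μb u t0 t := hμb.2 u t0 t0 v t ht00 le_rfl (h0s.trans hv1) hv2
      have e3 : 0 ≤ μa u t0 v := hμa.1 u t0 v ht00 (hs0.trans hv1)
      have e4 : 0 ≤ μb u t0 v := hμb.1 u t0 v ht00 (hs0.trans hv1)
      rw [hA]
      exact max_le_max le_rfl (max_le_max (max_le_max (max_le_max
        (hϑ.mono' (hσ3.2.2.2 _ e3) (hσ3.mono' e3 e1)) (hϑ.mono' e4 e2)) e1) le_rfl)
    have hγS : γ (supT 𝒯 y s t) ≤ max (γ^[i + 1] (β r 0)) (max A (max C r0)) := by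
      have h3 := hγ.le_of_le_max (hnn s t hsT hs0 hst h2) hS
      rw [← Function.iterate_succ_apply' γ i] at h3
      have h4 := hγ.le_max_r0 hγr (z := max A (max C r0)) (le_max_of_le_left hA0)
      have h5 : r0 ≤ max A (max C r0) := le_max_of_le_right (le_max_right _ _)
      exact h3.trans (max_le_max le_rfl (h4.trans (max_le le_rfl h5)))
    -- bound on the state
    have hX : x s ≤ max (M i) (max (σ3 (μa u t0 t)) (μb u t0 t)) := by
      rcases Nat.eq_zero_or_pos i with h0 | hpos
      · subst h0
        have : s = t0 := by simp [hs, hTs0]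
        rw [this, hM0]
        exact le_max_of_le_left hxr
      · have e := hH2 t0 s ht0 hsT ht00 h0s hsτ
        have e0 : s - t0 = ∑ j ∈ Finset.range (i + 1), Ts j := by rw [hs]; ring
        have e1 := hσ1.mono' hxnn hxr
        have e2 : supT 𝒯 y t0 s ≤ max (max (β r 0) (μa u t0 t)) (max C r0) :=
          (hbase s h0s hsτ).trans (max_le_max (max_le_max le_rfl
            (hμa.2 u t0 t0 s t ht00 le_rfl h0s hst)) le_rfl)
        have e3 := hσ3.le_of_le_max (hnn t0 s ht0 ht00 h0s hsτ) e2
        have e4 := hσ3.le_of_le_max (a := max (β r 0) (μa u t0 t))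
          (le_max_of_le_right hann) le_rfl
        have e5 : μb u t0 s ≤ μb u t0 t := hμb.2 u t0 t0 s t ht00 le_rfl h0s hst
        rw [e0] at e
        rw [hMi i hpos]
        refine e.trans ?_
        refine max_le (max_le ?_ ?_) (max_le (e3.trans (max_le (e4.trans (max_le ?_ ?_)) ?_))
          (max_le ?_ ?_)) <;>
          simp only [le_max_iff, e1, e5, le_refl, true_or, or_true]
    have hB : β (x s) (t - s) ≤ max (γ^[i + 1] (β r 0)) (max A (max C r0)) := by
      have hts : 0 ≤ t - s := hTi.trans hst'
      have anti : ∀ z, 0 ≤ z → ∀ a, 0 ≤ a → a ≤ t - s → β z (t - s) ≤ β z a :=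
        fun z hz a ha hat => (hβ.2 z hz).2.1 (mem_Ici.2 ha) (mem_Ici.2 hts) hat
      have k := hβ.1 (t - s) hts
      have hd' := hdec (i + 1) (by omega)
      simp only [Nat.add_sub_cancel] at hd'
      rcases le_max_iff.1 hX with q | q
      · exact le_max_of_le_left ((k.mono' hxs q).trans
          ((anti _ (hxs.trans q) _ hTi hst').trans hd'))
      · refine le_max_of_le_right (le_max_of_le_left ?_)
        rw [hA]
        refine le_max_of_le_left ?_
        rcases le_max_iff.1 q with q | q
        · exact le_max_of_le_left ((k.mono' hxs q).trans (anti _ (hxs.trans q) _ le_rfl hts))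
        · exact le_max_of_le_right ((k.mono' hxs q).trans (anti _ (hxs.trans q) _ le_rfl hts))
    have hμ : μa u s t ≤ A := by
      rw [hA]
      exact le_max_of_le_right (hμa.2 u t0 s t t ht00 h0s hst le_rfl)
    rw [← hA]
    refine (hH1 s t hsT ht hs0 hst h2).trans (max_le (max_le hB hγS) (max_le ?_ ?_))
    · exact le_max_of_le_right (le_max_of_le_left hμ)
    · exact le_max_of_le_right (le_max_of_le_right (le_max_left _ _))
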